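/- Let L be a finite semidistrim lattice with rowmotion Row_L. For every x ∈ L, Row_L(x) is a maximal element of the set {z ∈ L : Pop↓(x) = x ∧ z}, and Row_L⁻¹(x) is a minimal element of the set {z ∈ L : Pop↑(x) = x ∨ z}. -/

import Mathlib

universe u

/-- An element of a lattice is join-irreducible if it covers exactly one element. -/
def JoinIrred {α : Type u} [Lattice α] (j : α) : Prop := ∃! y : α, y ⋖ j

/-- An element of a lattice is meet-irreducible if it is covered by exactly one element. -/
def MeetIrred {α : Type u} [Lattice α] (m : α) : Prop := ∃! y : α, m ⋖ y

/-- `j` is join-prime if `j ≤ x ⊔ y` implies `j ≤ x` or `j ≤ y`. -/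
def JoinPrime {α : Type u} [Lattice α] (j : α) : Prop :=
  ∀ x y : α, j ≤ x ⊔ y → j ≤ x ∨ j ≤ y

/-- `m` is meet-prime if `x ⊓ y ≤ m` implies `x ≤ m` or `y ≤ m`. -/
def MeetPrime {α : Type u} [Lattice α] (m : α) : Prop :=
  ∀ x y : α, x ⊓ y ≤ m → x ≤ m ∨ y ≤ m

/-- `(j0, m0)` is a prime pair: the lattice is the disjoint union of `[⊥, m0]` and `[j0, ⊤]`,
i.e. every element satisfies exactly one of `z ≤ m0` or `j0 ≤ z`. -/
def IsPrimePair {α : Type u} [Lattice α] (j0 m0 : α) : Prop :=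
  ∀ z : α, (z ≤ m0 ∨ j0 ≤ z) ∧ ¬(z ≤ m0 ∧ j0 ≤ z)

/-- A pairing is a bijection `κ` from join-irreducibles to meet-irreducibles such that
`κ j` is maximal in `{z | j ⊓ z = j_*}` and `j = κ⁻¹ (κ j)` is minimal in
`{z | κ j ⊔ z = (κ j)^*}`. -/
def IsPairing {α : Type u} [Lattice α]
    (κ : {j : α // JoinIrred j} → {m : α // MeetIrred m}) : Prop :=
  Function.Bijective κ ∧
    (∀ (j : {j : α // JoinIrred j}) (jst : α), jst ⋖ j.1 →
      Maximal (fun z : α => j.1 ⊓ z = jst) (κ j).1) ∧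
    (∀ (j : {j : α // JoinIrred j}) (mst : α), (κ j).1 ⋖ mst →
      Minimal (fun z : α => (κ j).1 ⊔ z = mst) j.1)

/-- The edge relation of the Galois graph: `j → j'` iff `j ≠ j'` and `j ≰ κ j'`. -/
def GaloisEdge {α : Type u} [Lattice α]
    (κ : {j : α // JoinIrred j} → {m : α // MeetIrred m})
    (j j' : {j : α // JoinIrred j}) : Prop :=
  j ≠ j' ∧ ¬ j.1 ≤ (κ j').1

/-- Independent sets of the Galois graph (no edge in either direction). -/
def IndepSet {α : Type u} [Lattice α]
    (κ : {j : α // JoinIrred j} → {m : α // MeetIrred m})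
    (S : Set {j : α // JoinIrred j}) : Prop :=
  ∀ j ∈ S, ∀ j' ∈ S, ¬ GaloisEdge κ j j'

/-- The downward label set `D_L(x)`: labels of the cover relations `y ⋖ x`. -/
def DLabel {α : Type u} [Lattice α]
    (κ : {j : α // JoinIrred j} → {m : α // MeetIrred m}) (x : α) :
    Set {j : α // JoinIrred j} :=
  {j | ∃ y : α, y ⋖ x ∧ j.1 ≤ x ∧ y ≤ (κ j).1}

/-- The upward label set `U_L(x)`: labels of the cover relations `x ⋖ y`. -/
def ULabel {α : Type u} [Lattice α]
    (κ : {j : α // JoinIrred j} → {m : α // MeetIrred m}) (x : α) :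
    Set {j : α // JoinIrred j} :=
  {j | ∃ y : α, x ⋖ y ∧ j.1 ≤ y ∧ x ≤ (κ j).1}

/-- A uniquely paired lattice is overlapping if every cover relation has a unique label. -/
def Overlapping {α : Type u} [Lattice α]
    (κ : {j : α // JoinIrred j} → {m : α // MeetIrred m}) : Prop :=
  ∀ x y : α, x ⋖ y → ∃! j : {j : α // JoinIrred j}, j.1 ≤ y ∧ x ≤ (κ j).1

/-- Compatibly dismantlable lattices: either a one-element lattice, or a uniquely paired
lattice with a prime pair `(j0, m0)` whose intervals `[j0, ⊤] = Set.Ici j0` and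
`[⊥, m0] = Set.Iic m0` are compatibly dismantlable, together with the compatibility
conditions relating the unique pairings via `α j = j0 ⊔ j` and `β m = m0 ⊓ m`. -/
inductive CompatiblyDismantlable : (β : Type u) → [Lattice β] → [Finite β] → Prop
  | singleton (β : Type u) [Lattice β] [Finite β] (h : Nat.card β = 1) :
      CompatiblyDismantlable β
  | step (β : Type u) [Lattice β] [Finite β]
      (κ : {j : β // JoinIrred j} → {m : β // MeetIrred m})
      (hκ : IsPairing κ) (huniq : ∀ κ', IsPairing κ' → κ' = κ)
      (j0 m0 : β) (hpp : IsPrimePair j0 m0)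
      (hup : CompatiblyDismantlable ↥(Set.Ici j0))
      (hdn : CompatiblyDismantlable ↥(Set.Iic m0))
      (κup : {j : ↥(Set.Ici j0) // JoinIrred j} → {m : ↥(Set.Ici j0) // MeetIrred m})
      (hκup : IsPairing κup) (hκupuniq : ∀ κ', IsPairing κ' → κ' = κup)
      (κdn : {j : ↥(Set.Iic m0) // JoinIrred j} → {m : ↥(Set.Iic m0) // MeetIrred m})
      (hκdn : IsPairing κdn) (hκdnuniq : ∀ κ', IsPairing κ' → κ' = κdn)
      (halpha : ∀ j : {j : β // JoinIrred j}, j0 ≤ (κ j).1 →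
          ∃ hji : JoinIrred (⟨j0 ⊔ j.1, Set.mem_Ici.mpr le_sup_left⟩ : ↥(Set.Ici j0)),
            (κup ⟨⟨j0 ⊔ j.1, Set.mem_Ici.mpr le_sup_left⟩, hji⟩).1.1 = (κ j).1)
      (halphainj : ∀ j j' : {j : β // JoinIrred j}, j0 ≤ (κ j).1 → j0 ≤ (κ j').1 →
          j0 ⊔ j.1 = j0 ⊔ j'.1 → j = j')
      (halphasurj : ∀ j' : {j : ↥(Set.Ici j0) // JoinIrred j},
          ∃ j : {j : β // JoinIrred j}, j0 ≤ (κ j).1 ∧ j0 ⊔ j.1 = j'.1.1)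
      (hbeta : ∀ (j : {j : β // JoinIrred j}) (h : j.1 ≤ m0),
          ∃ hji : JoinIrred (⟨j.1, Set.mem_Iic.mpr h⟩ : ↥(Set.Iic m0)),
            (κdn ⟨⟨j.1, Set.mem_Iic.mpr h⟩, hji⟩).1.1 = m0 ⊓ (κ j).1)
      (hbetainj : ∀ j j' : {j : β // JoinIrred j}, j.1 ≤ m0 → j'.1 ≤ m0 →
          m0 ⊓ (κ j).1 = m0 ⊓ (κ j').1 → j = j')
      (hbetasurj : ∀ m' : {m : ↥(Set.Iic m0) // MeetIrred m},
          ∃ j : {j : β // JoinIrred j}, j.1 ≤ m0 ∧ m0 ⊓ (κ j).1 = m'.1.1) :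
      CompatiblyDismantlable β

/-- A lattice is semidistrim if it is compatibly dismantlable and the downward and upward
label sets of every element are independent sets of the Galois graph. -/
def Semidistrim (β : Type u) [Lattice β] [Finite β] : Prop :=
  CompatiblyDismantlable β ∧
    ∀ κ : {j : β // JoinIrred j} → {m : β // MeetIrred m}, IsPairing κ →
      ∀ x : β, IndepSet κ (DLabel κ x) ∧ IndepSet κ (ULabel κ x)

/-- The pop-stack sorting operator `Pop↓(x) = x ⊓ ⋀{y | y ⋖ x}`. -/
def PopDown {α : Type u} [CompleteLattice α] (x : α) : α := x ⊓ sInf {y : α | y ⋖ x}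

/-- The dual pop-stack sorting operator `Pop↑(x) = x ⊔ ⋁{y | x ⋖ y}`. -/
def PopUp {α : Type u} [CompleteLattice α] (x : α) : α := x ⊔ sSup {y : α | x ⋖ y}

theorem ici_cov {β : Type u} [Lattice β] {a x y : β} (h : x ⋖ y) (hx : a ≤ x) (hy : a ≤ y) :
    (⟨x, hx⟩ : ↥(Set.Ici a)) ⋖ ⟨y, hy⟩ :=
  ⟨h.1, fun c h1 h2 => h.2 (c := c.1) h1 h2⟩

theorem iic_cov {β : Type u} [Lattice β] {a x y : β} (h : x ⋖ y) (hx : x ≤ a) (hy : y ≤ a) :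
    (⟨x, hx⟩ : ↥(Set.Iic a)) ⋖ ⟨y, hy⟩ :=
  ⟨h.1, fun c h1 h2 => h.2 (c := c.1) h1 h2⟩

theorem not_le_kappa {β : Type u} [Lattice β]
    {κ : {j : β // JoinIrred j} → {m : β // MeetIrred m}} (hκ : IsPairing κ)
    (j : {j : β // JoinIrred j}) : ¬ j.1 ≤ (κ j).1 := by
  intro h
  obtain ⟨s, hs, -⟩ := j.2
  have h1 := (hκ.2.1 j s hs).prop
  have h2 : j.1 = s := (inf_eq_left.mpr h).symm.trans h1
  exact hs.1.ne h2.symm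

theorem label_exists (β : Type u) [Lattice β] [Finite β] (h : CompatiblyDismantlable β) :
    ∀ κ : {j : β // JoinIrred j} → {m : β // MeetIrred m}, IsPairing κ →
      ∀ x y : β, x ⋖ y → ∃ j : {j : β // JoinIrred j}, j.1 ≤ y ∧ x ≤ (κ j).1 := by
  induction h with
  | singleton β h =>
    intro κ hκ x y hxy
    have := (Nat.card_eq_one_iff_unique.mp h).1
    exact absurd (Subsingleton.elim x y) hxy.1.ne
  | step β κ hκ huniq j0 m0 hpp hup hdn κup hκup hκupuniq κdn hκdn hκdnuniq
      halpha halphainj halphasurj hbeta hbetainj hbetasurj ihup ihdn =>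
    intro κ' hκ' x y hxy
    obtain rfl := huniq κ' hκ'
    by_cases hx : j0 ≤ x
    · have hy : j0 ≤ y := hx.trans hxy.le
      obtain ⟨k, hk1, hk2⟩ := ihup κup hκup _ _ (ici_cov hxy hx hy)
      obtain ⟨j, hj1, hj2⟩ := halphasurj k
      obtain ⟨hji, hj3⟩ := halpha j hj1
      have hk : (⟨⟨j0 ⊔ j.1, Set.mem_Ici.mpr le_sup_left⟩, hji⟩ :
          {j : ↥(Set.Ici j0) // JoinIrred j}) = k := Subtype.ext (Subtype.ext hj2)
      rw [hk] at hj3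
      refine ⟨j, ?_, ?_⟩
      · have h1 : k.1.1 ≤ y := hk1
        exact le_sup_right.trans (hj2.le.trans h1)
      · have h1 : x ≤ (κup k).1.1 := hk2
        exact h1.trans hj3.le
    · have hx' : x ≤ m0 := (hpp x).1.resolve_right hx
      by_cases hy : y ≤ m0
      · obtain ⟨k, hk1, hk2⟩ := ihdn κdn hκdn _ _ (iic_cov hxy hx' hy)
        obtain ⟨j, hj1, hj2⟩ := hbetasurj (κdn k)
        obtain ⟨hji, hj3⟩ := hbeta j hj1
        have hk := hκdn.1.1 (Subtype.ext (Subtype.ext (hj3.trans hj2)))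
        refine ⟨j, ?_, ?_⟩
        · have h1 : k.1.1 ≤ y := hk1
          rw [← hk] at h1
          exact h1
        · have h1 : x ≤ (κdn k).1.1 := hk2
          rw [← hj2] at h1
          exact h1.trans inf_le_right
      · have hy' : j0 ≤ y := (hpp y).1.resolve_left hy
        have hnot : ¬ j0 ≤ m0 := fun h => (hpp j0).2 ⟨h, le_rfl⟩
        have hlt : ∀ z, z < j0 → z ≤ j0 ⊓ m0 := fun z hz =>
          le_inf hz.le ((hpp z).1.resolve_right (not_le_of_gt hz))
        have hcov : j0 ⊓ m0 ⋖ j0 :=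
          ⟨lt_of_le_of_ne inf_le_left (fun h => hnot (inf_eq_left.mp h)),
            fun z h1 h2 => absurd h1 (not_lt_of_ge (hlt z h2))⟩
        have hji : JoinIrred j0 := ⟨j0 ⊓ m0, hcov, fun z hz => by
          by_contra hne
          exact hz.2 (lt_of_le_of_ne (hlt z hz.1) hne) hcov.1⟩
        refine ⟨⟨j0, hji⟩, hy', hx'.trans ?_⟩
        have hm := hκ'.2.1 ⟨j0, hji⟩ _ hcov
        have h1 := (hpp (κ' ⟨j0, hji⟩).1).1.resolve_right (not_le_kappa hκ' ⟨j0, hji⟩)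
        exact hm.2 (y := m0) rfl h1

theorem row_key {α : Type u} [CompleteLattice α] [Finite α]
    (κ : {j : α // JoinIrred j} → {m : α // MeetIrred m}) (hκ : IsPairing κ)
    (hl : ∀ x y : α, x ⋖ y → ∃ j : {j : α // JoinIrred j}, j.1 ≤ y ∧ x ≤ (κ j).1)
    (x y : α) (hxy : ULabel κ y = DLabel κ x) :
    Maximal (fun z : α => PopDown x = x ⊓ z) y ∧
    Minimal (fun z : α => PopUp y = y ⊔ z) x := by
  have hD : ∀ j ∈ DLabel κ x, j.1 ≤ x ∧ y ≤ (κ j).1 := by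
    intro j hj
    have hj' := hj
    rw [← hxy] at hj'
    obtain ⟨_, _, h1, _⟩ := hj
    obtain ⟨_, _, _, h2⟩ := hj'
    exact ⟨h1, h2⟩
  have hdcov : ∀ c, c ⋖ x → ∃ j ∈ DLabel κ x, c = x ⊓ (κ j).1 := by
    intro c hc
    obtain ⟨j, h1, h2⟩ := hl c x hc
    refine ⟨j, ⟨c, hc, h1, h2⟩, ?_⟩
    rcases hc.eq_or_eq (le_inf hc.le h2) inf_le_left with h | h
    · exact h.symm
    · exact absurd (h1.trans (inf_eq_left.mp h)) (not_le_kappa hκ j)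
  have hucov : ∀ c, y ⋖ c → ∃ j ∈ DLabel κ x, c = y ⊔ j.1 := by
    intro c hc
    obtain ⟨j, h1, h2⟩ := hl y c hc
    refine ⟨j, hxy ▸ ⟨c, hc, h1, h2⟩, ?_⟩
    rcases hc.eq_or_eq le_sup_left (sup_le hc.le h1) with h | h
    · exact absurd ((sup_eq_left.mp h).trans h2) (not_le_kappa hκ j)
    · exact h.symm
  have hpdk : ∀ j ∈ DLabel κ x, PopDown x ≤ (κ j).1 := by
    rintro j ⟨c, hc, h1, h2⟩
    exact (inf_le_right.trans (sInf_le (show c ∈ {z | z ⋖ x} from hc))).trans h2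
  have hpuk : ∀ j ∈ DLabel κ x, j.1 ≤ PopUp y := by
    intro j hj
    rw [← hxy] at hj
    obtain ⟨c, hc, h1, h2⟩ := hj
    exact h1.trans ((le_sSup (show c ∈ {z | y ⋖ z} from hc)).trans le_sup_right)
  -- y is the meet of the kappa labels
  have hyge : ∀ w, (∀ j ∈ DLabel κ x, w ≤ (κ j).1) → w ≤ y := by
    intro w hw
    by_contra hn
    obtain ⟨c, hc, hcw⟩ := exists_covBy_le_of_lt (left_lt_sup.mpr hn)
    obtain ⟨j, hj, rfl⟩ := hucov c hc
    exact not_le_kappa hκ j ((le_sup_right.trans hcw).trans (sup_le (hD j hj).2 (hw j hj)))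
  have hxle : ∀ w, (∀ j ∈ DLabel κ x, j.1 ≤ w) → x ≤ w := by
    intro w hw
    by_contra hn
    obtain ⟨c, hwc, hc⟩ := exists_le_covBy_of_lt (inf_lt_left.mpr hn)
    obtain ⟨j, hj, rfl⟩ := hdcov c hc
    exact not_le_kappa hκ j ((le_inf (hD j hj).1 (hw j hj)).trans (hwc.trans inf_le_right))
  refine ⟨⟨?_, ?_⟩, ⟨?_, ?_⟩⟩
  · apply le_antisymm (le_inf inf_le_left (hyge _ hpdk))
    refine le_inf inf_le_left (le_sInf ?_)
    intro c hc
    obtain ⟨j, hj, rfl⟩ := hdcov c hc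
    exact inf_le_inf_left _ (hD j hj).2
  · intro z hz hyz
    apply hyge
    intro j hj
    by_contra hn
    have hne : ¬ z ≤ y := fun h => hn (h.trans (hD j hj).2)
    obtain ⟨c, hc, hcz⟩ := exists_covBy_le_of_lt (lt_of_le_not_ge hyz hne)
    obtain ⟨i, hi, rfl⟩ := hucov c hc
    have h1 : i.1 ≤ x ⊓ z := le_inf (hD i hi).1 (le_sup_right.trans hcz)
    rw [← show PopDown x = x ⊓ z from hz] at h1
    exact not_le_kappa hκ i (h1.trans (hpdk i hi))
  · apply le_antisymm
    · refine sup_le le_sup_left (sSup_le ?_)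
      intro c hc
      obtain ⟨j, hj, rfl⟩ := hucov c hc
      exact sup_le_sup_left (hD j hj).1 _
    · exact sup_le le_sup_left (hxle _ hpuk)
  · intro z hz hzx
    by_contra hne
    obtain ⟨c, hzc, hc⟩ := exists_le_covBy_of_lt (lt_of_le_not_ge hzx hne)
    obtain ⟨i, hi, rfl⟩ := hdcov c hc
    have h1 := hpuk i hi
    rw [show PopUp y = y ⊔ z from hz] at h1
    exact not_le_kappa hκ i (h1.trans (sup_le (hD i hi).2 (hzc.trans inf_le_right)))

/-- `Row(x)` is a maximal element of `{z | Pop↓(x) = x ⊓ z}` and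
`Row⁻¹(x)` is a minimal element of `{z | Pop↑(x) = x ⊔ z}`. -/
theorem stmt18 {α : Type u} [CompleteLattice α] [Finite α]
    (hsd : Semidistrim α)
    (κ : {j : α // JoinIrred j} → {m : α // MeetIrred m})
    (hκ : IsPairing κ) (huniq : ∀ κ', IsPairing κ' → κ' = κ)
    (Row RowInv : α → α)
    (hRow : ∀ x : α, ULabel κ (Row x) = DLabel κ x)
    (hInv1 : Function.LeftInverse RowInv Row)
    (hInv2 : Function.RightInverse RowInv Row)
    (x : α) :
    Maximal (fun z : α => PopDown x = x ⊓ z) (Row x) ∧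
    Minimal (fun z : α => PopUp x = x ⊔ z) (RowInv x) := by
  have hl := label_exists α hsd.1 κ hκ
  refine ⟨(row_key κ hκ hl x (Row x) (hRow x)).1, ?_⟩
  have h := hRow (RowInv x)
  rw [hInv2 x] at h
  exact (row_key κ hκ hl (RowInv x) x h).2
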